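/- arXiv:1507.04974 — 5 statements merged into one kernel-verified Lean document; each statement's English description precedes it below -/
import Mathlib

section
/- Let (Z₁, ρ₁) and (Z₂, ρ₂) be metric spaces without isolated points and let f : Z₁ → Z₂ be a homeomorphism that is Moebius, i.e. preserves metric cross-ratios of all quadruples of pairwise distinct points. Then f is conformal: for every ξ ∈ Z₁ the limit df(ξ) = lim_{η→ξ, η≠ξ} ρ₂(f(ξ), f(η))/ρ₁(ξ, η) exists and is a positive real number. -/
open Filter Topology

/-- A Moebius homeomorphism between metric spaces without isolated points is conformal:
at every point the limit of `dist (f ξ) (f η) / dist ξ η` as `η → ξ`, `η ≠ ξ`,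
exists and is a positive real number. -/
theorem moebius_is_conformal {Z₁ Z₂ : Type*} [MetricSpace Z₁] [MetricSpace Z₂]
    (h₁ : ∀ x : Z₁, (𝓝[≠] x).NeBot) (h₂ : ∀ y : Z₂, (𝓝[≠] y).NeBot)
    (f : Z₁ ≃ₜ Z₂)
    (hMoebius : ∀ ξ ξ' η η' : Z₁,
      ξ ≠ ξ' → ξ ≠ η → ξ ≠ η' → ξ' ≠ η → ξ' ≠ η' → η ≠ η' →
      dist (f ξ) (f η) * dist (f ξ') (f η') /
          (dist (f ξ) (f η') * dist (f ξ') (f η)) =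
        dist ξ η * dist ξ' η' / (dist ξ η' * dist ξ' η)) :
    ∀ ξ : Z₁, ∃ d : ℝ, 0 < d ∧
      Tendsto (fun η => dist (f ξ) (f η) / dist ξ η) (𝓝[≠] ξ) (𝓝 d) := by
  intro ξ
  have := h₁ ξ
  have hne : ∀ᶠ x in 𝓝[≠] ξ, x ≠ ξ := eventually_mem_nhdsWithin
  have avoid : ∀ a : Z₁, a ≠ ξ → ∀ᶠ x in 𝓝[≠] ξ, x ≠ a := fun a ha =>
    (eventually_ne_nhds ha.symm).filter_mono nhdsWithin_le_nhds
  obtain ⟨a, ha⟩ := hne.exists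
  obtain ⟨b, hb, hba⟩ := (hne.and (avoid a ha)).exists
  have pos : ∀ x y : Z₁, x ≠ y → 0 < dist x y ∧ 0 < dist (f x) (f y) := fun x y h =>
    ⟨dist_pos.2 h, dist_pos.2 (f.injective.ne h)⟩
  obtain ⟨p₁, q₁⟩ := pos ξ b hb.symm
  obtain ⟨p₂, q₂⟩ := pos a ξ ha
  obtain ⟨p₃, q₃⟩ := pos a b hba.symm
  refine ⟨dist (f ξ) (f b) / dist ξ b * (dist (f a) (f ξ) / dist a ξ) /
    (dist (f a) (f b) / dist a b), by positivity, ?_⟩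
  have hlim : Tendsto (fun η => dist (f ξ) (f b) / dist ξ b * (dist (f a) (f η) / dist a η) /
      (dist (f a) (f b) / dist a b)) (𝓝 ξ)
      (𝓝 (dist (f ξ) (f b) / dist ξ b * (dist (f a) (f ξ) / dist a ξ) /
        (dist (f a) (f b) / dist a b))) := by
    refine Tendsto.div_const (Tendsto.const_mul _ (Tendsto.div ?_ ?_ p₂.ne')) _
    · exact tendsto_const_nhds.dist f.continuous.continuousAt
    · exact tendsto_const_nhds.dist tendsto_id
  refine (hlim.mono_left nhdsWithin_le_nhds).congr' ?_
  filter_upwards [hne, avoid a ha, avoid b hb] with η hη hηa hηb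
  obtain ⟨p₄, q₄⟩ := pos ξ η hη.symm
  obtain ⟨p₅, q₅⟩ := pos a η hηa.symm
  have h := hMoebius ξ a η b ha.symm hη.symm hb.symm hηa.symm hba.symm hηb
  rw [div_eq_div_iff (by positivity) (by positivity)] at h
  rw [div_mul_div_comm, div_div_div_eq, div_eq_div_iff (by positivity) (by positivity)]
  linear_combination -h
end

section
/- Let (Z₁, ρ₁) and (Z₂, ρ₂) be metric spaces without isolated points and let f : Z₁ → Z₂ be a homeomorphism that is Moebius, i.e. preserves metric cross-ratios of all quadruples of pairwise distinct points. Then f is C¹ conformal: there exists a continuous function d : Z₁ → ℝ with d(ξ) > 0 for all ξ such that for every ξ ∈ Z₁, the quotient ρ₂(f(ξ), f(η))/ρ₁(ξ, η) tends to d(ξ) as η → ξ with η ≠ ξ. -/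
open Filter Topology

/-- The factor by which `f` scales the distance between two points. -/
noncomputable def distRatio {X Y : Type*} [MetricSpace X] [MetricSpace Y] (f : X → Y)
    (x y : X) : ℝ :=
  dist (f x) (f y) / dist x y

section distRatio

variable {X Y : Type*} [MetricSpace X] [MetricSpace Y]

theorem distRatio_comm (f : X → Y) (x y : X) : distRatio f x y = distRatio f y x := by
  simp only [distRatio, dist_comm]

theorem distRatio_pos {f : X → Y} (hf : Function.Injective f) {x y : X} (h : x ≠ y) :
    0 < distRatio f x y :=
  div_pos (dist_pos.2 (hf.ne h)) (dist_pos.2 h)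

theorem continuousAt_distRatio {f : X → Y} (hf : Continuous f) {a x : X} (h : a ≠ x) :
    ContinuousAt (fun y => distRatio f a y) x :=
  (continuous_const.dist hf).continuousAt.div (continuous_const.dist continuous_id).continuousAt
    (dist_ne_zero.2 h)

/-- Scaling factors of a Moebius homeomorphism `f` converge at every point `ξ`, and the limit can
be computed from any two distinct points other than `ξ`. -/
theorem tendsto_distRatio (f : X ≃ₜ Y)
    (hMoebius : ∀ ξ ξ' η η' : X,
      ξ ≠ ξ' → ξ ≠ η → ξ ≠ η' → ξ' ≠ η → ξ' ≠ η' → η ≠ η' →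
      dist (f ξ) (f η) * dist (f ξ') (f η') /
          (dist (f ξ) (f η') * dist (f ξ') (f η)) =
        dist ξ η * dist ξ' η' / (dist ξ η' * dist ξ' η))
    {a b ξ : X} (hab : a ≠ b) (ha : ξ ≠ a) (hb : ξ ≠ b) :
    Tendsto (fun η => distRatio f ξ η) (𝓝[≠] ξ)
      (𝓝 (distRatio f ξ b * distRatio f a ξ / distRatio f a b)) := by
  have hcont : ContinuousAt
      (fun η => distRatio f ξ b * distRatio f a η / distRatio f a b) ξ :=
    ((continuousAt_distRatio f.continuous ha.symm).const_mul _).div_const _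
  refine (hcont.tendsto.mono_left nhdsWithin_le_nhds).congr' ?_
  filter_upwards [self_mem_nhdsWithin, mem_nhdsWithin_of_mem_nhds (isOpen_ne.mem_nhds ha),
    mem_nhdsWithin_of_mem_nhds (isOpen_ne.mem_nhds hb)] with η hη hηa hηb
  have hξη : ξ ≠ η := Ne.symm hη
  have key := hMoebius ξ a η b ha hξη hb (Ne.symm hηa) hab hηb
  have hf : ∀ {x y : X}, x ≠ y → dist (f x) (f y) ≠ 0 := fun h =>
    dist_ne_zero.2 (f.injective.ne h)
  have e1 := hf hξη
  have e2 := hf hb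
  have e3 := hf (Ne.symm hηa)
  have e4 := hf hab
  have d1 := dist_ne_zero.2 hξη
  have d2 := dist_ne_zero.2 hb
  have d3 := dist_ne_zero.2 (Ne.symm hηa)
  have d4 := dist_ne_zero.2 hab
  rw [div_eq_div_iff (mul_ne_zero e2 e3) (mul_ne_zero d2 d3)] at key
  unfold distRatio
  rw [div_mul_div_comm, div_div_div_eq, div_eq_div_iff (by positivity) d1]
  linear_combination -key

end distRatio

/-- A Moebius homeomorphism between metric spaces without isolated points is C¹ conformal:
there is a continuous, everywhere positive derivative function `d` such that at every point
`dist (f ξ) (f η) / dist ξ η → d ξ` as `η → ξ`, `η ≠ ξ`. -/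
theorem moebius_is_C1_conformal {Z₁ Z₂ : Type*} [MetricSpace Z₁] [MetricSpace Z₂]
    (h₁ : ∀ x : Z₁, (𝓝[≠] x).NeBot) (h₂ : ∀ y : Z₂, (𝓝[≠] y).NeBot)
    (f : Z₁ ≃ₜ Z₂)
    (hMoebius : ∀ ξ ξ' η η' : Z₁,
      ξ ≠ ξ' → ξ ≠ η → ξ ≠ η' → ξ' ≠ η → ξ' ≠ η' → η ≠ η' →
      dist (f ξ) (f η) * dist (f ξ') (f η') /
          (dist (f ξ) (f η') * dist (f ξ') (f η)) =
        dist ξ η * dist ξ' η' / (dist ξ η' * dist ξ' η)) :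
    ∃ d : Z₁ → ℝ, Continuous d ∧ ∀ ξ : Z₁, 0 < d ξ ∧
      Tendsto (fun η => dist (f ξ) (f η) / dist ξ η) (𝓝[≠] ξ) (𝓝 (d ξ)) := by
  have hlim : ∀ a b ξ : Z₁, a ≠ b → ξ ≠ a → ξ ≠ b →
      Tendsto (fun η => distRatio f ξ η) (𝓝[≠] ξ)
        (𝓝 (distRatio f ξ b * distRatio f a ξ / distRatio f a b)) :=
    fun a b ξ hab ha hb => tendsto_distRatio f hMoebius hab ha hb
  have hpair : ∀ ξ : Z₁, ∃ a b : Z₁, a ≠ b ∧ ξ ≠ a ∧ ξ ≠ b := by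
    intro ξ
    have := h₁ ξ
    obtain ⟨a, ha⟩ := (eventually_mem_nhdsWithin (a := ξ) (s := {ξ}ᶜ)).exists
    have hne : ∀ᶠ b in 𝓝[≠] ξ, b ≠ a :=
      eventually_nhdsWithin_of_eventually_nhds (isOpen_ne.mem_nhds (Ne.symm ha))
    obtain ⟨b, hba, hb⟩ := (hne.and eventually_mem_nhdsWithin).exists
    exact ⟨a, b, hba.symm, Ne.symm ha, Ne.symm hb⟩
  have hex : ∀ ξ : Z₁, ∃ c : ℝ, 0 < c ∧
      Tendsto (fun η => distRatio f ξ η) (𝓝[≠] ξ) (𝓝 c) := by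
    intro ξ
    obtain ⟨a, b, hab, ha, hb⟩ := hpair ξ
    exact ⟨_, div_pos (mul_pos (distRatio_pos f.injective hb) (distRatio_pos f.injective ha.symm))
      (distRatio_pos f.injective hab), hlim a b ξ hab ha hb⟩
  choose d hpos hd using hex
  refine ⟨d, continuous_iff_continuousAt.2 fun ξ => ?_, fun ξ => ⟨hpos ξ, hd ξ⟩⟩
  obtain ⟨a, b, hab, ha, hb⟩ := hpair ξ
  have hcont : ContinuousAt
      (fun x => distRatio f x b * distRatio f a x / distRatio f a b) ξ := by
    simp only [distRatio_comm f _ b]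
    exact ((continuousAt_distRatio f.continuous hb.symm).mul
      (continuousAt_distRatio f.continuous ha.symm)).div_const _
  refine hcont.congr ?_
  filter_upwards [isOpen_ne.mem_nhds ha, isOpen_ne.mem_nhds hb] with x hxa hxb
  have := h₁ x
  exact tendsto_nhds_unique (hlim a b x hab hxa hxb) (hd x)
end

section
/- Let (Z₁, ρ₁) and (Z₂, ρ₂) be metric spaces without isolated points and let f : Z₁ → Z₂ be a homeomorphism that is locally Moebius, i.e. every point ξ ∈ Z₁ has an open neighborhood U such that the restriction of f to U preserves metric cross-ratios of all quadruples of pairwise distinct points of U. Then f is C¹ conformal: there exists a continuous function d : Z₁ → ℝ with d(ξ) > 0 for all ξ such that for every ξ ∈ Z₁, the quotient ρ₂(f(ξ), f(η))/ρ₁(ξ, η) tends to d(ξ) as η → ξ with η ≠ ξ. -/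
open Filter Topology

/-- If `f` preserves the cross-ratios of pairwise distinct points of an open set `U`, its metric
difference quotient at `ξ ∈ U` converges to an expression in the difference quotients between `ξ`
and two auxiliary points `a, b ∈ U`. -/
lemma tendsto_dist_div_dist_of_crossRatio_eq {X Y : Type*} [MetricSpace X] [MetricSpace Y]
    {f : X → Y} (hf : Continuous f) (hinj : Function.Injective f) {U : Set X} (hU : IsOpen U)
    (hM : ∀ ξ ξ' η η' : X, ξ ∈ U → ξ' ∈ U → η ∈ U → η' ∈ U →
        ξ ≠ ξ' → ξ ≠ η → ξ ≠ η' → ξ' ≠ η → ξ' ≠ η' → η ≠ η' →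
        dist (f ξ) (f η) * dist (f ξ') (f η') /
            (dist (f ξ) (f η') * dist (f ξ') (f η)) =
          dist ξ η * dist ξ' η' / (dist ξ η' * dist ξ' η))
    {a b ξ : X} (ha : a ∈ U) (hb : b ∈ U) (hξ : ξ ∈ U) (hab : a ≠ b) (hξa : ξ ≠ a)
    (hξb : ξ ≠ b) :
    Tendsto (fun η => dist (f ξ) (f η) / dist ξ η) (𝓝[≠] ξ)
      (𝓝 (dist (f ξ) (f a) / dist ξ a * (dist (f b) (f ξ) / dist b ξ) /
        (dist (f b) (f a) / dist b a))) := by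
  have hcont : ContinuousAt (fun η => dist (f ξ) (f a) / dist ξ a * (dist (f b) (f η) / dist b η) /
      (dist (f b) (f a) / dist b a)) ξ := by
    have hne : dist b ξ ≠ 0 := dist_ne_zero.2 hξb.symm
    exact (continuousAt_const.mul
      (ContinuousAt.div (by fun_prop) (by fun_prop) hne)).div_const _
  refine (hcont.tendsto.mono_left nhdsWithin_le_nhds).congr' ?_
  filter_upwards [self_mem_nhdsWithin, nhdsWithin_le_nhds (hU.mem_nhds hξ),
    nhdsWithin_le_nhds (isOpen_ne.mem_nhds hξa), nhdsWithin_le_nhds (isOpen_ne.mem_nhds hξb)]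
    with η hηξ hηU hηa hηb
  have key := hM ξ b η a hξ hb hηU ha hξb (Ne.symm hηξ) hξa (Ne.symm hηb) hab.symm hηa
  have h1 := dist_ne_zero.2 hξa
  have h2 := dist_ne_zero.2 (Ne.symm hηb)
  have h3 := dist_ne_zero.2 hab.symm
  have h4 := dist_ne_zero.2 (Ne.symm hηξ)
  have h5 := dist_ne_zero.2 (hinj.ne hξa)
  have h6 := dist_ne_zero.2 (hinj.ne (Ne.symm hηb))
  have h7 := dist_ne_zero.2 (hinj.ne hab.symm)
  rw [div_eq_div_iff (mul_ne_zero h5 h6) (mul_ne_zero h1 h2)] at key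
  field_simp
  linarith

/-- A locally Moebius homeomorphism between metric spaces without isolated points is
C¹ conformal. -/
theorem locally_moebius_is_C1_conformal {Z₁ Z₂ : Type*} [MetricSpace Z₁] [MetricSpace Z₂]
    (h₁ : ∀ x : Z₁, (𝓝[≠] x).NeBot) (h₂ : ∀ y : Z₂, (𝓝[≠] y).NeBot)
    (f : Z₁ ≃ₜ Z₂)
    (hLocMoebius : ∀ ξ₀ : Z₁, ∃ U : Set Z₁, IsOpen U ∧ ξ₀ ∈ U ∧
      ∀ ξ ξ' η η' : Z₁, ξ ∈ U → ξ' ∈ U → η ∈ U → η' ∈ U →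
        ξ ≠ ξ' → ξ ≠ η → ξ ≠ η' → ξ' ≠ η → ξ' ≠ η' → η ≠ η' →
        dist (f ξ) (f η) * dist (f ξ') (f η') /
            (dist (f ξ) (f η') * dist (f ξ') (f η)) =
          dist ξ η * dist ξ' η' / (dist ξ η' * dist ξ' η)) :
    ∃ d : Z₁ → ℝ, Continuous d ∧ ∀ ξ : Z₁, 0 < d ξ ∧
      Tendsto (fun η => dist (f ξ) (f η) / dist ξ η) (𝓝[≠] ξ) (𝓝 (d ξ)) := by
  have hloc : ∀ ξ₀ : Z₁, ∃ D : Z₁ → ℝ, ContinuousAt D ξ₀ ∧ ∀ᶠ ξ in 𝓝 ξ₀, 0 < D ξ ∧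
      Tendsto (fun η => dist (f ξ) (f η) / dist ξ η) (𝓝[≠] ξ) (𝓝 (D ξ)) := by
    intro ξ₀
    obtain ⟨U, hU, hξ₀, hM⟩ := hLocMoebius ξ₀
    have hUmem : U ∈ 𝓝[≠] ξ₀ := nhdsWithin_le_nhds (hU.mem_nhds hξ₀)
    obtain ⟨a, haU, ha⟩ := (h₁ ξ₀).nonempty_of_mem (inter_mem hUmem self_mem_nhdsWithin)
    have haξ : ξ₀ ≠ a := Ne.symm ha
    obtain ⟨b, ⟨hbU, hb⟩, hba⟩ := (h₁ ξ₀).nonempty_of_mem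
      (inter_mem (inter_mem hUmem self_mem_nhdsWithin)
        (nhdsWithin_le_nhds (isOpen_ne.mem_nhds haξ)))
    have hbξ : ξ₀ ≠ b := Ne.symm hb
    have hf := f.continuous
    refine ⟨fun ξ => dist (f ξ) (f a) / dist ξ a * (dist (f b) (f ξ) / dist b ξ) /
      (dist (f b) (f a) / dist b a), ?_, ?_⟩
    · have hne : dist ξ₀ a ≠ 0 := dist_ne_zero.2 haξ
      have hne' : dist b ξ₀ ≠ 0 := dist_ne_zero.2 hb
      refine ContinuousAt.div_const (ContinuousAt.mul ?_ ?_) _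
      · exact ContinuousAt.div (by fun_prop) (by fun_prop) hne
      · exact ContinuousAt.div (by fun_prop) (by fun_prop) hne'
    · filter_upwards [hU.mem_nhds hξ₀, isOpen_ne.mem_nhds haξ, isOpen_ne.mem_nhds hbξ]
        with ξ hξU hξa hξb
      refine ⟨?_, tendsto_dist_div_dist_of_crossRatio_eq hf f.injective hU hM haU hbU hξU
        (Ne.symm hba) hξa hξb⟩
      have h1 := dist_pos.2 hξa
      have h2 := dist_pos.2 (Ne.symm hξb)
      have h3 := dist_pos.2 hba
      have h4 := dist_pos.2 (f.injective.ne hξa)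
      have h5 := dist_pos.2 (f.injective.ne (Ne.symm hξb))
      have h6 := dist_pos.2 (f.injective.ne hba)
      positivity
  have hlim : ∀ ξ : Z₁, ∃ l : ℝ, 0 < l ∧
      Tendsto (fun η => dist (f ξ) (f η) / dist ξ η) (𝓝[≠] ξ) (𝓝 l) := fun ξ =>
    let ⟨D, _, hD⟩ := hloc ξ
    ⟨D ξ, hD.self_of_nhds⟩
  choose d hd using hlim
  refine ⟨d, continuous_iff_continuousAt.2 fun ξ₀ => ?_, hd⟩
  obtain ⟨D, hDcont, hD⟩ := hloc ξ₀
  refine hDcont.congr ?_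
  filter_upwards [hD] with ξ hξ
  have := h₁ ξ
  exact tendsto_nhds_unique hξ.2 (hd ξ).2
end

section
/- Let (Z₁, ρ₁) and (Z₂, ρ₂) be metric spaces without isolated points and let f : Z₁ → Z₂ be a homeomorphism that is Moebius, i.e. preserves metric cross-ratios of all quadruples of pairwise distinct points. Then f satisfies the geometric mean-value theorem: there exists a function d : Z₁ → ℝ with d(ξ) > 0 for all ξ, such that for every ξ ∈ Z₁ the quotient ρ₂(f(ξ), f(η))/ρ₁(ξ, η) tends to d(ξ) as η → ξ with η ≠ ξ, and for all ξ, η ∈ Z₁ one has ρ₂(f(ξ), f(η))² = d(ξ)·d(η)·ρ₁(ξ, η)². -/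
open Filter Topology

/-- A continuous injective map that preserves metric cross-ratios has, at each point `a`, the
distance quotients converging to an expression in the quotients of any triple `a, b, c`. -/
theorem tendsto_dist_div_dist_of_moebius {Z₁ Z₂ : Type*} [MetricSpace Z₁] [MetricSpace Z₂]
    {f : Z₁ → Z₂} (hf : Continuous f) (hinj : Function.Injective f)
    (hMoebius : ∀ ξ ξ' η η' : Z₁,
      ξ ≠ ξ' → ξ ≠ η → ξ ≠ η' → ξ' ≠ η → ξ' ≠ η' → η ≠ η' →
      dist (f ξ) (f η) * dist (f ξ') (f η') /
          (dist (f ξ) (f η') * dist (f ξ') (f η)) =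
        dist ξ η * dist ξ' η' / (dist ξ η' * dist ξ' η))
    {a b c : Z₁} (hab : a ≠ b) (hac : a ≠ c) (hbc : b ≠ c) :
    Tendsto (fun x => dist (f a) (f x) / dist a x) (𝓝[≠] a)
      (𝓝 (dist (f a) (f b) / dist a b * (dist (f c) (f a) / dist c a) /
        (dist (f c) (f b) / dist c b))) := by
  have hlim : Tendsto (fun x => dist (f a) (f b) / dist a b * (dist (f c) (f x) / dist c x) /
      (dist (f c) (f b) / dist c b)) (𝓝[≠] a)
      (𝓝 (dist (f a) (f b) / dist a b * (dist (f c) (f a) / dist c a) /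
        (dist (f c) (f b) / dist c b))) := by
    have hcont : ContinuousAt (fun x => dist (f c) (f x) / dist c x) a :=
      ContinuousAt.div (by fun_prop) (by fun_prop) (dist_ne_zero.2 hac.symm)
    exact ((hcont.tendsto.mono_left nhdsWithin_le_nhds).const_mul _).div_const _
  refine hlim.congr' ?_
  filter_upwards [self_mem_nhdsWithin, nhdsWithin_le_nhds (isOpen_ne.mem_nhds hab),
    nhdsWithin_le_nhds (isOpen_ne.mem_nhds hac)] with x hxa hxb hxc
  have hxa : x ≠ a := hxa
  have hxb : x ≠ b := hxb
  have hxc : x ≠ c := hxc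
  have h := hMoebius a c x b hac hxa.symm hab hxc.symm hbc.symm hxb
  have hne : ∀ {u v : Z₁}, u ≠ v → dist u v ≠ 0 ∧ dist (f u) (f v) ≠ 0 := fun huv =>
    ⟨dist_ne_zero.2 huv, dist_ne_zero.2 (hinj.ne huv)⟩
  obtain ⟨h1, h1'⟩ := hne hab
  obtain ⟨h2, h2'⟩ := hne hxa.symm
  obtain ⟨h3, h3'⟩ := hne hxc.symm
  obtain ⟨h4, h4'⟩ := hne hbc.symm
  rw [div_eq_div_iff (mul_ne_zero h1' h3') (mul_ne_zero h1 h3)] at h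
  field_simp
  linear_combination -h

/-- A Moebius homeomorphism between metric spaces without isolated points satisfies the
geometric mean-value theorem: it has an everywhere positive conformal derivative `d` and
`dist (f ξ) (f η) ^ 2 = d ξ * d η * dist ξ η ^ 2` for all `ξ η`. -/
theorem moebius_geometric_mean_value {Z₁ Z₂ : Type*} [MetricSpace Z₁] [MetricSpace Z₂]
    (h₁ : ∀ x : Z₁, (𝓝[≠] x).NeBot) (h₂ : ∀ y : Z₂, (𝓝[≠] y).NeBot)
    (f : Z₁ ≃ₜ Z₂)
    (hMoebius : ∀ ξ ξ' η η' : Z₁,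
      ξ ≠ ξ' → ξ ≠ η → ξ ≠ η' → ξ' ≠ η → ξ' ≠ η' → η ≠ η' →
      dist (f ξ) (f η) * dist (f ξ') (f η') /
          (dist (f ξ) (f η') * dist (f ξ') (f η)) =
        dist ξ η * dist ξ' η' / (dist ξ η' * dist ξ' η)) :
    ∃ d : Z₁ → ℝ,
      (∀ ξ : Z₁, 0 < d ξ ∧
        Tendsto (fun η => dist (f ξ) (f η) / dist ξ η) (𝓝[≠] ξ) (𝓝 (d ξ))) ∧
      ∀ ξ η : Z₁, dist (f ξ) (f η) ^ 2 = d ξ * d η * dist ξ η ^ 2 := by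
  have hlim {a b c : Z₁} (hab : a ≠ b) (hac : a ≠ c) (hbc : b ≠ c) :=
    tendsto_dist_div_dist_of_moebius f.continuous f.injective hMoebius hab hac hbc
  have hpos {u v : Z₁} (huv : u ≠ v) : 0 < dist u v ∧ 0 < dist (f u) (f v) :=
    ⟨dist_pos.2 huv, dist_pos.2 (f.injective.ne huv)⟩
  have hthird {a b : Z₁} (hab : a ≠ b) : ∃ c, a ≠ c ∧ b ≠ c := by
    have := h₁ a
    have hev : ∀ᶠ c in 𝓝[≠] a, a ≠ c ∧ b ≠ c := by
      filter_upwards [self_mem_nhdsWithin, nhdsWithin_le_nhds (isOpen_ne.mem_nhds hab)]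
        with c hca hcb
      exact ⟨Ne.symm hca, Ne.symm hcb⟩
    exact hev.exists
  have hderiv (ξ : Z₁) : ∃ r : ℝ, 0 < r ∧
      Tendsto (fun η => dist (f ξ) (f η) / dist ξ η) (𝓝[≠] ξ) (𝓝 r) := by
    have := h₁ ξ
    obtain ⟨b, hb⟩ := Filter.nonempty_of_mem (self_mem_nhdsWithin : {ξ}ᶜ ∈ 𝓝[≠] ξ)
    have hb : ξ ≠ b := Ne.symm hb
    obtain ⟨c, hξc, hbc⟩ := hthird hb
    refine ⟨_, ?_, hlim hb hξc hbc⟩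
    obtain ⟨p1, p1'⟩ := hpos hb
    obtain ⟨p2, p2'⟩ := hpos hξc.symm
    obtain ⟨p3, p3'⟩ := hpos hbc.symm
    positivity
  choose d hd using hderiv
  refine ⟨d, hd, fun ξ η => ?_⟩
  rcases eq_or_ne ξ η with rfl | hne
  · simp
  obtain ⟨c, hξc, hηc⟩ := hthird hne
  have := h₁ ξ
  have := h₁ η
  rw [tendsto_nhds_unique (hd ξ).2 (hlim hne hξc hηc),
    tendsto_nhds_unique (hd η).2 (hlim hne.symm hηc hξc), dist_comm η ξ, dist_comm (f η) (f ξ)]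
  obtain ⟨p1, p1'⟩ := hpos hne
  obtain ⟨p2, p2'⟩ := hpos hξc.symm
  obtain ⟨p3, p3'⟩ := hpos hηc.symm
  field_simp
end

section
/- Let (Z₁, ρ₁) and (Z₂, ρ₂) be metric spaces without isolated points, let f : Z₁ → Z₂ be a homeomorphism that is Moebius, i.e. preserves metric cross-ratios of all quadruples of pairwise distinct points, and let a, b, ξ ∈ Z₁ be three pairwise distinct points. Then the quotient ρ₂(f(ξ), f(η))/ρ₁(ξ, η) tends, as η → ξ with η ≠ ξ, to the positive real number (ρ₂(f(ξ), f(a))·ρ₂(f(ξ), f(b))·ρ₁(a, b)) / (ρ₁(ξ, a)·ρ₁(ξ, b)·ρ₂(f(a), f(b))); in particular the conformal derivative of f at ξ is given by this explicit formula. -/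
open Filter Topology

/-- For a Moebius homeomorphism `f` between metric spaces without isolated points and
three pairwise distinct points `a, b, ξ`, the conformal derivative of `f` at `ξ` is given
by the explicit formula
`(dist (f ξ) (f a) * dist (f ξ) (f b) * dist a b) / (dist ξ a * dist ξ b * dist (f a) (f b))`,
which is a positive real number. -/
theorem moebius_derivative_formula {Z₁ Z₂ : Type*} [MetricSpace Z₁] [MetricSpace Z₂]
    (h₁ : ∀ x : Z₁, (𝓝[≠] x).NeBot) (h₂ : ∀ y : Z₂, (𝓝[≠] y).NeBot)
    (f : Z₁ ≃ₜ Z₂)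
    (hMoebius : ∀ ξ ξ' η η' : Z₁,
      ξ ≠ ξ' → ξ ≠ η → ξ ≠ η' → ξ' ≠ η → ξ' ≠ η' → η ≠ η' →
      dist (f ξ) (f η) * dist (f ξ') (f η') /
          (dist (f ξ) (f η') * dist (f ξ') (f η)) =
        dist ξ η * dist ξ' η' / (dist ξ η' * dist ξ' η))
    (a b ξ : Z₁) (hab : a ≠ b) (haξ : a ≠ ξ) (hbξ : b ≠ ξ) :
    0 < dist (f ξ) (f a) * dist (f ξ) (f b) * dist a b /
        (dist ξ a * dist ξ b * dist (f a) (f b)) ∧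
      Tendsto (fun η => dist (f ξ) (f η) / dist ξ η) (𝓝[≠] ξ)
        (𝓝 (dist (f ξ) (f a) * dist (f ξ) (f b) * dist a b /
          (dist ξ a * dist ξ b * dist (f a) (f b)))) := by
  have dist_ne : ∀ {x y : Z₁}, x ≠ y → dist x y ≠ 0 := fun h => dist_ne_zero.2 h
  have dist_map_ne : ∀ {x y : Z₁}, x ≠ y → dist (f x) (f y) ≠ 0 :=
    fun h => dist_ne_zero.2 (f.injective.ne h)
  constructor
  · have := dist_pos.2 hab
    have := dist_pos.2 haξ.symm
    have := dist_pos.2 hbξ.symm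
    have := dist_pos.2 (f.injective.ne hab)
    have := dist_pos.2 (f.injective.ne haξ.symm)
    have := dist_pos.2 (f.injective.ne hbξ.symm)
    positivity
  · have hcont : ContinuousAt (fun η => dist (f η) (f a) * dist (f ξ) (f b) * dist a b /
        (dist η a * dist ξ b * dist (f a) (f b))) ξ := by
      have hf : Continuous f := f.continuous
      refine ContinuousAt.div (by fun_prop) (by fun_prop) ?_
      exact mul_ne_zero (mul_ne_zero (dist_ne haξ.symm) (dist_ne hbξ.symm)) (dist_map_ne hab)
    refine (hcont.tendsto.mono_left nhdsWithin_le_nhds).congr' ?_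
    have ha : ∀ᶠ η in 𝓝[≠] ξ, η ≠ a :=
      nhdsWithin_le_nhds (isOpen_ne.mem_nhds haξ.symm)
    have hb : ∀ᶠ η in 𝓝[≠] ξ, η ≠ b :=
      nhdsWithin_le_nhds (isOpen_ne.mem_nhds hbξ.symm)
    filter_upwards [self_mem_nhdsWithin, ha, hb] with η hη hηa hηb
    have hηξ : ξ ≠ η := Ne.symm hη
    have key := hMoebius ξ a η b haξ.symm hηξ hbξ.symm hηa.symm hab hηb
    rw [dist_comm a η, dist_comm (f a) (f η)] at key
    have h1 := dist_ne hηξ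
    have h2 := dist_ne hηa
    have h3 := dist_ne hbξ.symm
    have h4 := dist_map_ne hηa
    have h5 := dist_map_ne hbξ.symm
    have h6 := dist_map_ne hab
    rw [div_eq_div_iff (mul_ne_zero h5 h4) (mul_ne_zero h3 h2)] at key
    rw [div_eq_div_iff (mul_ne_zero (mul_ne_zero h2 h3) h6) h1]
    linear_combination -key
end
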